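/- Let σ ∈ S(n) satisfy σ(n) = b ≠ n and σ(a) = n with a,b ∈ {1,…,n−1}, and set σ̂ = (b n)·σ, a permutation fixing n (an element of S(n−1)). Then for all p,q ∈ {1,…,n−1} and all i,j ∈ {1,…,w}: V(σ)^{t_n} · u^{pq}_{ij} = d^{δ_{ap}} · Σ_{k=1}^{w} φ_{ki}((b n−1) σ̂ (a p)(p n−1)) · u^{bq}_{kj}, where the permutation (b n−1) σ̂ (a p)(p n−1) fixes both n−1 and n and is regarded as an element of S(n−2). -/

import Mathlib

/-- The permutation operator `V(σ)` on `(ℂ^d)^{⊗ n}`, realized as the square matrix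
indexed by functions `f g : Fin n → Fin d`, with entry `1` if `g = f ∘ σ` and `0` otherwise. -/
noncomputable def V (n d : ℕ) (σ : Equiv.Perm (Fin n)) :
    Matrix (Fin n → Fin d) (Fin n → Fin d) ℂ :=
  Matrix.of fun f g => if g = f ∘ σ then 1 else 0

/-- Partial transpose of a matrix on `(ℂ^d)^{⊗ n}` at position `p`. -/
noncomputable def pt {n d : ℕ} (p : Fin n)
    (A : Matrix (Fin n → Fin d) (Fin n → Fin d) ℂ) :
    Matrix (Fin n → Fin d) (Fin n → Fin d) ℂ :=
  Matrix.of fun f g =>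
    A (Function.update f p (g p)) (Function.update g p (f p))

/-- The last position `n` of the tensor product, as an element of `Fin n`. -/
def lastIdx (n : ℕ) (hn : 1 ≤ n) : Fin n := ⟨n - 1, by omega⟩

/-- The matrix operators `E_{ij} = (w/(n−2)!) Σ_{σ ∈ S(n−2)} φ_{ji}(σ⁻¹) V(σ)`, where the
sum runs over the subgroup of `S(n)` fixing both positions `ln1` (= `n−1`) and `ln` (= `n`). -/
noncomputable def Emat (n d w : ℕ) (ln ln1 : Fin n)
    (φ : Equiv.Perm (Fin n) → Matrix (Fin w) (Fin w) ℂ) (i j : Fin w) :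
    Matrix (Fin n → Fin d) (Fin n → Fin d) ℂ :=
  ((w : ℂ) / (Nat.factorial (n - 2) : ℂ)) •
    ∑ σ ∈ Finset.univ.filter
        (fun σ : Equiv.Perm (Fin n) => σ ln = ln ∧ σ ln1 = ln1),
      (φ σ⁻¹ j i) • V n d σ

/-- The elements `u^{ab}_{ij} = V((a n))^{t_n} · V((a n−1)) · E_{ij} · V((b n−1))`, where
`ln` is position `n`, `ln1` is position `n−1`, and `(x y)` with `x = y` is the identity. -/
noncomputable def umat (n d w : ℕ) (ln ln1 : Fin n)
    (φ : Equiv.Perm (Fin n) → Matrix (Fin w) (Fin w) ℂ)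
    (a b : Fin n) (i j : Fin w) :
    Matrix (Fin n → Fin d) (Fin n → Fin d) ℂ :=
  pt ln (V n d (Equiv.swap a ln)) * V n d (Equiv.swap a ln1) *
    Emat n d w ln ln1 φ i j * V n d (Equiv.swap b ln1)

open Equiv

section PermutationOperators

variable {n d : ℕ}

lemma mul_V_apply (A : Matrix (Fin n → Fin d) (Fin n → Fin d) ℂ) (τ : Perm (Fin n))
    (f g : Fin n → Fin d) : (A * V n d τ) f g = A f (g ∘ ⇑τ⁻¹) := by
  have key : ∀ h : Fin n → Fin d, g = h ∘ τ ↔ h = g ∘ ⇑τ⁻¹ := by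
    refine fun h => ⟨?_, ?_⟩ <;> rintro rfl <;> funext x <;> simp
  simp [Matrix.mul_apply, V, key]

lemma V_mul_apply (A : Matrix (Fin n → Fin d) (Fin n → Fin d) ℂ) (τ : Perm (Fin n))
    (f g : Fin n → Fin d) : (V n d τ * A) f g = A (f ∘ τ) g := by
  simp [Matrix.mul_apply, V]

lemma V_mul_V (σ τ : Perm (Fin n)) : V n d σ * V n d τ = V n d (σ * τ) := by
  ext f g
  rw [V_mul_apply]
  rfl

lemma pt_mul_V {p : Fin n} {τ : Perm (Fin n)} (hτ : τ p = p)
    (A : Matrix (Fin n → Fin d) (Fin n → Fin d) ℂ) :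
    pt p (A * V n d τ) = pt p A * V n d τ := by
  have hτ' : τ⁻¹ p = p := by rw [Perm.inv_eq_iff_eq, hτ]
  ext f g
  simp only [mul_V_apply, pt, Matrix.of_apply, Function.comp_apply, hτ']
  congr 1
  funext x
  by_cases hx : x = p
  · rw [hx, Function.comp_apply, hτ']
    simp
  · have : τ⁻¹ x ≠ p := by rwa [Ne, Perm.inv_eq_iff_eq, hτ]
    simp only [Function.comp_apply, Function.update_of_ne hx, Function.update_of_ne this]

lemma pt_V_mul {p : Fin n} {τ : Perm (Fin n)} (hτ : τ p = p)
    (A : Matrix (Fin n → Fin d) (Fin n → Fin d) ℂ) :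
    pt p (V n d τ * A) = V n d τ * pt p A := by
  ext f g
  simp only [V_mul_apply, pt, Matrix.of_apply, Function.comp_apply, hτ]
  congr 1
  funext x
  by_cases hx : x = p
  · simp [hx, hτ]
  · have : τ x ≠ p := fun h => hx (τ.injective (h.trans hτ.symm))
    simp [hx, this]

lemma V_mul_pt_V_swap {p : Fin n} {τ : Perm (Fin n)} (hτ : τ p = p) (c : Fin n) :
    V n d τ * pt p (V n d (swap c p)) = pt p (V n d (swap (τ c) p)) * V n d τ := by
  rw [← pt_V_mul hτ, ← pt_mul_V hτ, V_mul_V, V_mul_V, Equiv.mul_swap_eq_swap_mul, hτ]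

lemma pt_V_swap_apply {p b : Fin n} (hb : b ≠ p) (f g : Fin n → Fin d) :
    pt p (V n d (swap b p)) f g =
      if f p = f b ∧ g b = g p ∧ ∀ x, x ≠ b → x ≠ p → g x = f x then 1 else 0 := by
  simp only [pt, V, Matrix.of_apply]
  refine if_congr ⟨fun h => ⟨?_, ?_, fun x hxb hxp => ?_⟩, fun ⟨h₁, h₂, h₃⟩ => ?_⟩ rfl rfl
  · simpa [hb] using congrFun h p
  · simpa [hb] using congrFun h b
  · simpa [hxb, hxp, swap_apply_of_ne_of_ne] using congrFun h x
  · funext x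
    by_cases hxp : x = p
    · subst hxp; simp [hb, h₁]
    · by_cases hxb : x = b
      · subst hxb; simp [hb, h₂]
      · simp [hxb, hxp, swap_apply_of_ne_of_ne, h₃]

lemma pt_V_swap_mul_apply {p b : Fin n} (hb : b ≠ p)
    (A : Matrix (Fin n → Fin d) (Fin n → Fin d) ℂ) (f h : Fin n → Fin d) :
    (pt p (V n d (swap b p)) * A) f h =
      if f p = f b then ∑ t, A (Function.update (Function.update f b t) p t) h else 0 := by
  rw [Matrix.mul_apply]
  split_ifs with hf
  · have key : ∀ g : Fin n → Fin d, pt p (V n d (swap b p)) f g =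
        ∑ t, if g = Function.update (Function.update f b t) p t then 1 else 0 := by
      intro g
      rw [pt_V_swap_apply hb]
      have : ∀ t, g = Function.update (Function.update f b t) p t ↔
          t = g p ∧ g b = g p ∧ ∀ x, x ≠ b → x ≠ p → g x = f x := by
        refine fun t => ⟨?_, ?_⟩
        · rintro rfl
          refine ⟨by simp, by simp [hb], fun x hxb hxp => by simp [hxb, hxp]⟩
        · rintro ⟨rfl, h₂, h₃⟩
          funext x
          by_cases hxp : x = p
          · subst hxp; simp
          · by_cases hxb : x = b
            · subst hxb; simp [hb, h₂]
            · simp [hxb, hxp, h₃]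
      simp [this, hf, ite_and]
    simp_rw [key, Finset.sum_mul]
    rw [Finset.sum_comm]
    simp
  · exact Finset.sum_eq_zero fun g _ => by simp [pt_V_swap_apply hb, hf]

lemma pt_V_swap_mul_pt_V_swap {p b c : Fin n} (hb : b ≠ p) (hc : c ≠ p) :
    pt p (V n d (swap b p)) * pt p (V n d (swap c p)) =
      ((d : ℂ) ^ (if b = c then 1 else 0 : ℕ)) •
        (pt p (V n d (swap b p)) * V n d (swap b c)) := by
  ext f h
  rw [pt_V_swap_mul_apply hb, Matrix.smul_apply, mul_V_apply, swap_inv]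
  simp only [pt_V_swap_apply hb, pt_V_swap_apply hc]
  by_cases hf : f p = f b
  swap
  · simp [hf]
  by_cases hbc : b = c
  · subst hbc
    have : ∀ t, (∀ x, x ≠ b → x ≠ p →
        h x = Function.update (Function.update f b t) p t x) ↔
        ∀ x, x ≠ b → x ≠ p → h x = f x := fun t =>
      forall_congr' fun x => forall_congr' fun hxb => forall_congr' fun hxp => by
        simp [hxb, hxp]
    simp [hf, hb, this]
  · have : ∀ t, (Function.update (Function.update f b t) p t p =
          Function.update (Function.update f b t) p t c ∧ h c = h p ∧
        ∀ x, x ≠ c → x ≠ p → h x = Function.update (Function.update f b t) p t x) ↔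
        t = f c ∧ h c = h p ∧ ∀ x, x ≠ b → x ≠ p → h (swap b c x) = f x := by
      intro t
      simp only [Function.update_self, Function.update_of_ne hc,
        Function.update_of_ne (Ne.symm hbc)]
      refine and_congr_right fun ht => and_congr_right fun _ => ⟨fun H x hxb hxp => ?_,
        fun H x hxc hxp => ?_⟩
      · by_cases hxc : x = c
        · subst hxc
          simpa [hb, ht] using H b hbc hb
        · simpa [hxb, hxp, hxc, swap_apply_of_ne_of_ne] using H x hxc hxp
      · by_cases hxb : x = b
        · subst hxb
          simpa [hb, ht] using H c (Ne.symm hbc) hc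
        · simpa [hxb, hxp, hxc, swap_apply_of_ne_of_ne] using H x hxb hxp
    simp only [this]
    simp [hf, hbc, ite_and, swap_apply_of_ne_of_ne (Ne.symm hb) (Ne.symm hc)]

lemma pt_V_mul_pt_V_swap {r a b p : Fin n} (hb : b ≠ r) (hp : p ≠ r)
    {σ : Perm (Fin n)} (hσr : σ r = b) (hσa : σ a = r) :
    pt r (V n d σ) * pt r (V n d (swap p r)) =
      ((d : ℂ) ^ (if a = p then 1 else 0 : ℕ)) •
        (pt r (V n d (swap b r)) * V n d (swap b r * σ * swap a p)) := by
  obtain ⟨τ, rfl⟩ : ∃ τ, σ = swap b r * τ := ⟨swap b r * σ, by simp⟩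
  have hτr : τ r = r := by
    have := congrArg (swap b r) hσr
    simpa using this
  have hτa : τ a = b := by
    have := congrArg (swap b r) hσa
    simpa using this
  have hτp : τ p ≠ r := fun h => hp (τ.injective (h.trans hτr.symm))
  have hiff : b = τ p ↔ a = p := by rw [← hτa, τ.injective.eq_iff]
  rw [← V_mul_V, pt_mul_V hτr, mul_assoc, V_mul_pt_V_swap hτr, ← mul_assoc,
    pt_V_swap_mul_pt_V_swap hb hτp, Matrix.smul_mul, mul_assoc, V_mul_V, swap_mul_self_mul,
    Equiv.mul_swap_eq_swap_mul, hτa]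
  simp only [hiff]

lemma V_mul_Emat {w : ℕ} {r s : Fin n} {φ : Perm (Fin n) → Matrix (Fin w) (Fin w) ℂ}
    (hmul : ∀ σ τ : Perm (Fin n),
      σ r = r → σ s = s → τ r = r → τ s = s → φ (σ * τ) = φ σ * φ τ)
    {ρ : Perm (Fin n)} (hr : ρ r = r) (hs : ρ s = s) (i j : Fin w) :
    V n d ρ * Emat n d w r s φ i j = ∑ k, φ ρ k i • Emat n d w r s φ k j := by
  have hfix : ∀ {τ : Perm (Fin n)} {x : Fin n}, τ x = x → τ⁻¹ x = x := fun h =>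
    Perm.inv_eq_iff_eq.2 h.symm
  simp only [Emat, Matrix.mul_smul, smul_comm (φ _ _ _), ← Finset.smul_sum]
  congr 1
  simp only [Finset.mul_sum, Matrix.mul_smul, V_mul_V, Finset.smul_sum]
  rw [Finset.sum_comm]
  refine Finset.sum_bij' (fun τ _ => ρ * τ) (fun τ _ => ρ⁻¹ * τ) ?_ ?_ ?_ ?_ ?_
  · intro τ hτ
    simp_all
  · intro τ hτ
    simp only [Finset.mem_filter, Finset.mem_univ, true_and] at hτ
    simp only [Finset.mem_filter, Finset.mem_univ, Perm.mul_apply, hτ.1, hτ.2,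
      hfix hr, hfix hs, and_self]
  · simp
  · simp
  · intro τ hτ
    simp only [Finset.mem_filter, Finset.mem_univ, true_and] at hτ
    have h₁ : (ρ * τ)⁻¹ r = r := hfix (by simp [hτ.1, hr])
    have h₂ : (ρ * τ)⁻¹ s = s := hfix (by simp [hτ.2, hs])
    have : φ τ⁻¹ = φ (ρ * τ)⁻¹ * φ ρ := by
      rw [← hmul _ _ h₁ h₂ hr hs]
      simp
    simp only [smul_smul, ← Finset.sum_smul, this, Matrix.mul_apply]
    simp only [mul_comm]

end PermutationOperators

open Matrix in
/-- Action of a partially transposed generator `V(σ)^{t_n}` (with `σ(n) = b ≠ n`,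
`σ(a) = n`) on the elements `u^{pq}_{ij}`:
`V(σ)^{t_n} · u^{pq}_{ij} = d^{δ_{ap}} Σ_k φ_{ki}((b n−1) σ̂ (a p)(p n−1)) · u^{bq}_{kj}`,
where `σ̂ = (b n)·σ` fixes `n`. -/
theorem pt_V_mul_umat (n d w : ℕ) (hn : 3 ≤ n) (hd : 1 ≤ d) (hw : 1 ≤ w)
    (ln ln1 : Fin n) (hln : (ln : ℕ) = n - 1) (hln1 : (ln1 : ℕ) = n - 2)
    (φ : Equiv.Perm (Fin n) → Matrix (Fin w) (Fin w) ℂ)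
    (hid : φ 1 = 1)
    (hmul : ∀ σ τ : Equiv.Perm (Fin n),
      σ ln = ln → σ ln1 = ln1 → τ ln = ln → τ ln1 = ln1 → φ (σ * τ) = φ σ * φ τ)
    (hunitary : ∀ σ : Equiv.Perm (Fin n), σ ln = ln → σ ln1 = ln1 → (φ σ)ᴴ * φ σ = 1)
    (hirred : ∀ M : Matrix (Fin w) (Fin w) ℂ,
      (∀ σ : Equiv.Perm (Fin n), σ ln = ln → σ ln1 = ln1 → M * φ σ = φ σ * M) →
      ∃ c : ℂ, M = c • (1 : Matrix (Fin w) (Fin w) ℂ))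
    (σ : Equiv.Perm (Fin n)) (a b : Fin n) (ha : a ≠ ln) (hb : b ≠ ln)
    (hσn : σ ln = b) (hσa : σ a = ln)
    (p q : Fin n) (hp : p ≠ ln) (hq : q ≠ ln) (i j : Fin w) :
    pt ln (V n d σ) * umat n d w ln ln1 φ p q i j =
      ((d : ℂ) ^ (if a = p then 1 else 0 : ℕ)) •
        ∑ k : Fin w,
          (φ (Equiv.swap b ln1 * (Equiv.swap b ln * σ) * Equiv.swap a p *
              Equiv.swap p ln1) k i) •
            umat n d w ln ln1 φ b q k j := by
  have hne : ln1 ≠ ln := fun h => by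
    have := congrArg Fin.val h
    omega
  set ρ := swap b ln1 * (swap b ln * σ) * swap a p * swap p ln1 with hρ
  have hρr : ρ ln = ln := by
    simp [hρ, swap_apply_of_ne_of_ne, ha.symm, hb.symm, hp.symm, hne.symm, hσn]
  have hρs : ρ ln1 = ln1 := by
    simp [hρ, hσa]
  have hfac : V n d (swap b ln * σ * swap a p) * V n d (swap p ln1) =
      V n d (swap b ln1) * V n d ρ := by
    rw [V_mul_V, V_mul_V, hρ]
    simp [mul_assoc]
  have hsum : pt ln (V n d (swap b ln)) * V n d (swap b ln1) *
      (V n d ρ * Emat n d w ln ln1 φ i j) * V n d (swap q ln1) =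
      ∑ k, φ ρ k i • umat n d w ln ln1 φ b q k j := by
    simp only [V_mul_Emat hmul hρr hρs, Finset.mul_sum, Finset.sum_mul, Matrix.mul_smul,
      Matrix.smul_mul, umat]
  rw [← hsum, umat, ← mul_assoc, ← mul_assoc, ← mul_assoc,
    pt_V_mul_pt_V_swap hb hp hσn hσa]
  simp only [Matrix.smul_mul]
  rw [mul_assoc (pt ln _) _ (V n d (swap p ln1)), hfac]
  simp only [mul_assoc]
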